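/- arXiv:2511.03885 — 2 statements merged into one kernel-verified Lean document; each statement's English description precedes it below -/
import Mathlib

section
/- Let n ≥ 5, I ∈ I_{2,n} and J ∈ I_{4,n} with R_{I,J} ≠ 0. If I and J have exactly one common index, then R_{I,J} has exactly 3 monomials in its support; if I and J are disjoint, then R_{I,J} has exactly 4 monomials in its support. -/
/-!
Common framework: iterated sequences for Gr(3,n), the matrix `A_S`, pullbacks of
Plücker coordinates, the weighted reverse lexicographic order, lowest-term
valuations, Plücker relations, weighting matrices and initial ideals.
-/

open MvPolynomial

noncomputable section

/-- Height of a positive root `(i,j) ↦ j - i`. -/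
def Ht (β : ℕ × ℕ) : ℕ := β.2 - β.1

/-- `IsIter n S` : `S` is an iterated sequence for `Gr(3,n)`: it starts (as base of the
iteration) from a PBW sequence for `Gr(3,4)`, i.e. an ordering of `((1,4),(2,4),(3,4))`,
and for each `r = 5, …, n` a triple `((i₁,r),(i₂,r),(i₃,r))` with `i₁,i₂,i₃ ∈ [r-1]`
pairwise distinct is prepended. -/
inductive IsIter : ℕ → List (ℕ × ℕ) → Prop
  | base (L : List (ℕ × ℕ)) : L.Perm [(1,4),(2,4),(3,4)] → IsIter 4 L
  | step (r : ℕ) (L : List (ℕ × ℕ)) (i₁ i₂ i₃ : ℕ) :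
      4 ≤ r → IsIter r L →
      1 ≤ i₁ → i₁ ≤ r → 1 ≤ i₂ → i₂ ≤ r → 1 ≤ i₃ → i₃ ≤ r →
      i₁ ≠ i₂ → i₁ ≠ i₃ → i₂ ≠ i₃ →
      IsIter (r+1) ((i₁, r+1) :: (i₂, r+1) :: (i₃, r+1) :: L)

/-- `Sorted k n I` : `I ∈ I_{k,n}`, a strictly increasing `k`-tuple in `{1,…,n}`. -/
def Sorted (k n : ℕ) (I : Fin k → ℕ) : Prop :=
  StrictMono I ∧ ∀ a, 1 ≤ I a ∧ I a ≤ n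

/-- `ℕ`-indexed square "matrices" (1-based indexing, size given by a parameter `n`). -/
abbrev NMat := ℕ → ℕ → MvPolynomial (ℕ × ℕ) ℂ

/-- Product of two `n × n` matrices, 1-based indexing. -/
def matMul (n : ℕ) (A B : NMat) : NMat := fun i j => ∑ k ∈ Finset.Icc 1 n, A i k * B k j

/-- Identity matrix. -/
def idN : NMat := fun i j => if i = j then 1 else 0

/-- The factor `1 + x_β f_β`, where `f_β` is the matrix unit in entry `β = (i,j)`. -/
def factor (β : ℕ × ℕ) : NMat := fun i j =>
  (if i = j then (1 : MvPolynomial (ℕ × ℕ) ℂ) else 0) +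
    (if i = β.1 ∧ j = β.2 then (MvPolynomial.X β : MvPolynomial (ℕ × ℕ) ℂ) else 0)

/-- `A_S := (1 + x_{β_N} f_{β_N}) ⋯ (1 + x_{β_1} f_{β_1})` for `S = (β_1, …, β_N)`. -/
def ASmat (n : ℕ) : List (ℕ × ℕ) → NMat
  | [] => idN
  | β :: L => matMul n (ASmat n L) (factor β)

/-- `φ_S^*(p̄_I)` : the determinant of the `3×3` submatrix of `A_S` on rows `(1,2,3)`
and columns `I = (i₁,i₂,i₃)`. -/
def phiStar (n : ℕ) (S : List (ℕ × ℕ)) (I : Fin 3 → ℕ) : MvPolynomial (ℕ × ℕ) ℂ :=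
  Matrix.det (Matrix.of fun a b : Fin 3 => ASmat n S (a.val + 1) (I b))

/-- `Ψ_S(a) = Σ_l a_l Ht(β_l)`, the height-weighted function (written on exponents). -/
def Psi (d : (ℕ × ℕ) →₀ ℕ) : ℕ := d.sum fun β c => c * Ht β

/-- `a <_lex b` : lexicographic comparison of exponent vectors, the coordinates being
read in the order `β_1, …, β_N` of the sequence `S`. -/
def lexLT (S : List (ℕ × ℕ)) (a b : (ℕ × ℕ) →₀ ℕ) : Prop :=
  ∃ k < S.length, (∀ m < k, a (S.getD m (0,0)) = b (S.getD m (0,0))) ∧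
    a (S.getD k (0,0)) < b (S.getD k (0,0))

/-- `a ≤_lex b` on coordinates indexed by `S`. -/
def lexLE (S : List (ℕ × ℕ)) (a b : (ℕ × ℕ) →₀ ℕ) : Prop :=
  lexLT S a b ∨ ∀ k < S.length, a (S.getD k (0,0)) = b (S.getD k (0,0))

/-- `a ≺_{Ψ_S} b` : the strict `Ψ_S`-weighted reverse lexicographic order:
`Ψ_S(a) < Ψ_S(b)`, or `Ψ_S(a) = Ψ_S(b)` and `a >_lex b`. -/
def psiLT (S : List (ℕ × ℕ)) (a b : (ℕ × ℕ) →₀ ℕ) : Prop :=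
  Psi a < Psi b ∨ (Psi a = Psi b ∧ lexLT S b a)

/-- `a ⪯_{Ψ_S} b`. -/
def psiLE (S : List (ℕ × ℕ)) (a b : (ℕ × ℕ) →₀ ℕ) : Prop :=
  Psi a < Psi b ∨ (Psi a = Psi b ∧ lexLE S b a)

open scoped Classical in
/-- The `⪯_{Ψ_S}`-minimum of the support of a polynomial (defaulting to `0` if no
minimum exists). -/
def minSupp (S : List (ℕ × ℕ)) (f : MvPolynomial (ℕ × ℕ) ℂ) : (ℕ × ℕ) →₀ ℕ :=
  if h : ∃ m ∈ f.support, ∀ m' ∈ f.support, psiLE S m m' then h.choose else 0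

/-- The lowest-term valuation `v_S(p̄_I)` : the `⪯_{Ψ_S}`-minimum of the support of
`φ_S^*(p̄_I)`. -/
def valS (n : ℕ) (S : List (ℕ × ℕ)) (I : Fin 3 → ℕ) : (ℕ × ℕ) →₀ ℕ :=
  minSupp S (phiStar n S I)

/-- The index set `I_{3,n}` of Plücker variables. -/
abbrev MI (n : ℕ) := {v : Fin 3 → ℕ // Sorted 3 n v}

/-- The Plücker polynomial ring `ℂ[p_K : K ∈ I_{3,n}]`. -/
abbrev PRing (n : ℕ) := MvPolynomial (MI n) ℂ

open scoped Classical in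
/-- The Plücker variable `p_K`, defined to be `0` if `K` is not strictly increasing
(in particular `p_{I ∪ j} = 0` if `j ∈ I`). -/
def pvar (n : ℕ) (K : Fin 3 → ℕ) : PRing n :=
  if h : Sorted 3 n K then MvPolynomial.X (⟨K, h⟩ : MI n) else 0

/-- `I ∪ j` : the sorted triple obtained by adjoining `j` to the pair `I`. -/
def insert3 (I : Fin 2 → ℕ) (j : ℕ) : Fin 3 → ℕ :=
  fun a => (List.insertionSort (· ≤ ·) [I 0, I 1, j]).getD a 0

/-- `J ∖ j` : the sorted triple obtained by removing `j` from the 4-tuple `J`. -/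
def erase4 (J : Fin 4 → ℕ) (j : ℕ) : Fin 3 → ℕ :=
  fun a => (([J 0, J 1, J 2, J 3]).erase j).getD a 0

/-- The Plücker relation
`R_{I,J} = Σ_{j ∈ J} (−1)^{#{i∈I : i<j} + #{j'∈J : j<j'}} p_{I∪j} p_{J∖j}`. -/
def Rrel (n : ℕ) (I : Fin 2 → ℕ) (J : Fin 4 → ℕ) : PRing n :=
  ∑ a : Fin 4,
    (-1 : PRing n) ^ ((Finset.univ.filter fun b : Fin 2 => I b < J a).card +
        (Finset.univ.filter fun b : Fin 4 => J a < J b).card) *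
      (pvar n (insert3 I (J a)) * pvar n (erase4 J (J a)))

/-- The Plücker ideal `𝓘_{3,n}`, generated by all Plücker relations. -/
def PluckerIdeal (n : ℕ) : Ideal (PRing n) :=
  Ideal.span {f | ∃ I J, Sorted 2 n I ∧ Sorted 4 n J ∧ f = Rrel n I J}

/-- `M_S · m = Σ_K m_K v_S(p̄_K)` : the weighting matrix applied to an exponent. -/
def MSdot (n : ℕ) (S : List (ℕ × ℕ)) (m : MI n →₀ ℕ) : (ℕ × ℕ) →₀ ℕ :=
  m.sum fun K c => c • valS n S K.val

open scoped Classical in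
/-- The initial form `In_{M_S}(f)` : the sum of the terms of `f` whose `M_S`-weight is
`⪯_{Ψ_S}`-minimal. -/
def inM (n : ℕ) (S : List (ℕ × ℕ)) (f : PRing n) : PRing n :=
  ∑ m ∈ f.support.filter fun m => ∀ m' ∈ f.support, psiLE S (MSdot n S m) (MSdot n S m'),
    MvPolynomial.monomial m (f.coeff m)

/-- The initial ideal `In_{M_S}(𝓘_{3,n}) = ⟨In_{M_S}(g) : g ∈ 𝓘_{3,n}, g ≠ 0⟩`. -/
def InIdeal (n : ℕ) (S : List (ℕ × ℕ)) : Ideal (PRing n) :=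
  Ideal.span {g | ∃ f, f ∈ PluckerIdeal n ∧ f ≠ 0 ∧ g = inM n S f}

/-- Evaluation of the `ℤ`-linear functional with coefficients `c` on an exponent
vector (i.e. an element `e ∈ (ℤ^{3(n-3)})^*` given by its coefficients). -/
def evalF (c : ℕ × ℕ → ℤ) (d : (ℕ × ℕ) →₀ ℕ) : ℤ := d.sum fun β m => c β * (m : ℤ)

/-- `v_S(p̄_{I∪j}) + v_S(p̄_{J∖j})`, the `M_S`-weight of the term of `R_{I,J}`
corresponding to `j = J a`. -/
def wvec (n : ℕ) (S : List (ℕ × ℕ)) (I : Fin 2 → ℕ) (J : Fin 4 → ℕ) (a : Fin 4) :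
    (ℕ × ℕ) →₀ ℕ :=
  valS n S (insert3 I (J a)) + valS n S (erase4 J (J a))

/-- A `ℤ`-linear functional `e` (given by its coefficients `c`) *preserves inequalities*
with respect to `S` if for every nonzero Plücker relation `R_{I,J}` and all
`s₁, s₂ ∈ J ∖ I`, `v_S(p̄_{I∪s₁}) + v_S(p̄_{J∖s₁}) ≺_{Ψ_S} v_S(p̄_{I∪s₂}) + v_S(p̄_{J∖s₂})`
implies the corresponding strict inequality of the values of `e`. -/
def PreservesIneq (n : ℕ) (S : List (ℕ × ℕ)) (c : ℕ × ℕ → ℤ) : Prop :=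
  ∀ (I : Fin 2 → ℕ) (J : Fin 4 → ℕ), Sorted 2 n I → Sorted 4 n J → Rrel n I J ≠ 0 →
    ∀ a b : Fin 4, (∀ t : Fin 2, I t ≠ J a) → (∀ t : Fin 2, I t ≠ J b) →
      psiLT S (wvec n S I J a) (wvec n S I J b) →
      evalF c (wvec n S I J a) < evalF c (wvec n S I J b)

end

theorem MvPolynomial.card_support_sum_monomial {R σ ι : Type*} [CommSemiring R] (s : Finset ι)
    (m : ι → σ →₀ ℕ) (c : ι → R) (hm : Set.InjOn m s) (hc : ∀ a ∈ s, c a ≠ 0) :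
    (∑ a ∈ s, MvPolynomial.monomial (m a) (c a)).support.card = s.card := by
  classical
  have hsupp : (∑ a ∈ s, MvPolynomial.monomial (m a) (c a)).support = s.image m := by
    ext d
    simp only [MvPolynomial.mem_support_iff, MvPolynomial.coeff_sum, MvPolynomial.coeff_monomial,
      Finset.mem_image]
    constructor
    · intro h
      obtain ⟨a, ha, hne⟩ := Finset.exists_ne_zero_of_sum_ne_zero h
      exact ⟨a, ha, by by_contra hd; simp [hd] at hne⟩
    · rintro ⟨a, ha, rfl⟩
      rw [Finset.sum_eq_single_of_mem a ha]
      · simpa using hc a ha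
      · intro b hb hba
        exact if_neg fun h => hba (hm hb ha h)
  rw [hsupp, Finset.card_image_of_injOn hm]

theorem insert3_eq {I : Fin 2 → ℕ} (hI : I 0 < I 1) (j : ℕ) :
    insert3 I j = if j < I 0 then ![j, I 0, I 1]
      else if j < I 1 then ![I 0, j, I 1] else ![I 0, I 1, j] := by
  funext a
  unfold insert3
  simp only [List.insertionSort, List.foldr, List.orderedInsert]
  split_ifs <;> fin_cases a <;>
    simp [List.orderedInsert] <;> (try split_ifs) <;> simp <;> grind

theorem mem_range_insert3 {I : Fin 2 → ℕ} (hI : I 0 < I 1) (j x : ℕ) :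
    x ∈ Set.range (insert3 I j) ↔ x = I 0 ∨ x = I 1 ∨ x = j := by
  rw [insert3_eq hI]
  split_ifs <;> simp <;> grind

theorem sorted_insert3_iff {n : ℕ} {I : Fin 2 → ℕ} (hI : Sorted 2 n I) {j : ℕ}
    (hj : 1 ≤ j ∧ j ≤ n) : Sorted 3 n (insert3 I j) ↔ ∀ t, I t ≠ j := by
  have h01 : I 0 < I 1 := hI.1 (by decide)
  have h0 := hI.2 0
  have h1 := hI.2 1
  rw [insert3_eq h01]
  split_ifs <;>
    simp [Sorted, Fin.strictMono_iff_lt_succ, Fin.forall_fin_succ] <;> grind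

theorem erase4_eq_succAbove {J : Fin 4 → ℕ} (hJ : StrictMono J) (a : Fin 4) :
    erase4 J (J a) = fun b => J (a.succAbove b) := by
  have hne : ∀ s t, J s = J t ↔ s = t := fun s t => hJ.injective.eq_iff
  funext b
  fin_cases a <;> fin_cases b <;> simp [erase4, hne, Fin.succAbove]

theorem sorted_erase4 {n : ℕ} {J : Fin 4 → ℕ} (hJ : Sorted 4 n J) (a : Fin 4) :
    Sorted 3 n (erase4 J (J a)) := by
  rw [erase4_eq_succAbove hJ.1]
  exact ⟨hJ.1.comp (Fin.strictMono_succAbove a), fun b => hJ.2 _⟩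

/-- The exponent of the monomial `p_K p_L`. -/
noncomputable def pairExp {n : ℕ} (K L : MI n) : MI n →₀ ℕ :=
  Finsupp.single K 1 + Finsupp.single L 1

theorem pairExp_eq_pairExp {n : ℕ} {K L K' L' : MI n} (h : pairExp K L = pairExp K' L') :
    K = K' ∨ K = L' := by
  classical
  have hK := DFunLike.congr_fun h K
  simp only [pairExp, Finsupp.add_apply, Finsupp.single_apply] at hK
  grind

theorem card_support_Rrel {n : ℕ} {I : Fin 2 → ℕ} {J : Fin 4 → ℕ} (hI : Sorted 2 n I)
    (hJ : Sorted 4 n J) (hIJ : ∃ t, ∀ s, I t ≠ J s) :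
    (Rrel n I J).support.card =
      (Finset.univ.filter fun a : Fin 4 => ∀ t, I t ≠ J a).card := by
  have h01 : I 0 < I 1 := hI.1 (by decide)
  let A : Finset (Fin 4) := Finset.univ.filter fun a => ∀ t, I t ≠ J a
  have hA : ∀ a, a ∈ A ↔ ∀ t, I t ≠ J a := by simp [A]
  have hs : ∀ a, Sorted 3 n (insert3 I (J a)) ↔ a ∈ A := fun a => by
    rw [hA, sorted_insert3_iff hI (hJ.2 a)]
  let L : Fin 4 → MI n := fun a => ⟨erase4 J (J a), sorted_erase4 hJ a⟩
  let K : A → MI n := fun a => ⟨insert3 I (J a), (hs a).2 a.2⟩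
  let e : Fin 4 → ℕ := fun a => (Finset.univ.filter fun b : Fin 2 => I b < J a).card +
    (Finset.univ.filter fun b : Fin 4 => J a < J b).card
  let c : Fin 4 → ℂ := fun a => (-1) ^ e a
  have hR : Rrel n I J =
      ∑ a ∈ A.attach, MvPolynomial.monomial (pairExp (K a) (L a)) (c a) := by
    rw [Rrel, ← Finset.sum_subset (Finset.subset_univ A), ← Finset.sum_attach A]
    · refine Finset.sum_congr rfl fun a _ => ?_
      rw [pvar, dif_pos ((hs a).2 a.2), pvar, dif_pos (sorted_erase4 hJ a)]
      have hc : (-1 : PRing n) ^ e a = MvPolynomial.C (c a) := by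
        simp only [c, map_pow, map_neg, map_one]
      change (-1 : PRing n) ^ e a * _ = _
      rw [hc, MvPolynomial.X, MvPolynomial.X, MvPolynomial.monomial_mul,
        MvPolynomial.C_mul_monomial, mul_one, mul_one, pairExp]
    · intro a _ ha
      rw [pvar, dif_neg (mt (hs a).1 ha)]
      simp
  rw [hR, MvPolynomial.card_support_sum_monomial, Finset.card_attach]
  · intro a _ b _ hab
    rcases pairExp_eq_pairExp hab with h | h
    · have h' : insert3 I (J a) = insert3 I (J b) := congrArg Subtype.val h
      have hmem : J a ∈ Set.range (insert3 I (J b)) := by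
        rw [← h', mem_range_insert3 h01]; simp
      rw [mem_range_insert3 h01] at hmem
      have ha := (hA a).1 a.2
      rcases hmem with h | h | h
      · exact absurd h.symm (ha 0)
      · exact absurd h.symm (ha 1)
      · exact Subtype.ext (hJ.1.injective h)
    · have h' : insert3 I (J a) = erase4 J (J b) := congrArg Subtype.val h
      obtain ⟨t, ht⟩ := hIJ
      have hmem : I t ∈ Set.range (insert3 I (J a)) := by
        rw [mem_range_insert3 h01]; fin_cases t <;> simp
      rw [h', erase4_eq_succAbove hJ.1] at hmem
      obtain ⟨s, hs⟩ := hmem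
      exact absurd hs.symm (ht _)
  · intro a _
    exact pow_ne_zero _ (by norm_num)

/-- A nonzero Plücker relation `R_{I,J}` has exactly 3 terms if `I` and `J` have exactly
one common index, and exactly 4 terms if `I` and `J` are disjoint. -/
theorem plucker_relation_terms (n : ℕ) (hn : 5 ≤ n) (I : Fin 2 → ℕ) (J : Fin 4 → ℕ)
    (hI : Sorted 2 n I) (hJ : Sorted 4 n J) (hR : Rrel n I J ≠ 0) :
    ((∃! x : ℕ, (∃ t, I t = x) ∧ ∃ s, J s = x) → (Rrel n I J).support.card = 3) ∧
    ((∀ (t : Fin 2) (s : Fin 4), I t ≠ J s) → (Rrel n I J).support.card = 4) := by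
  constructor
  · rintro ⟨x, ⟨⟨t₀, rfl⟩, s₀, hs₀⟩, huniq⟩
    have huniq' : ∀ t s, I t = J s → t = t₀ ∧ s = s₀ := fun t s h =>
      have hx : I t = I t₀ := huniq _ ⟨⟨t, rfl⟩, s, h.symm⟩
      ⟨hI.1.injective hx, hJ.1.injective (by rw [← h, hx, hs₀])⟩
    obtain ⟨t, ht⟩ := exists_ne t₀
    rw [card_support_Rrel hI hJ ⟨t, fun s h => ht (huniq' t s h).1⟩]
    have hfilter : (Finset.univ.filter fun a : Fin 4 => ∀ t, I t ≠ J a) =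
        Finset.univ.erase s₀ := by
      ext a
      simp only [Finset.mem_filter, Finset.mem_univ, true_and, Finset.mem_erase, and_true]
      exact ⟨fun h ha => h t₀ (by rw [ha, hs₀]), fun h t hta => h (huniq' t a hta).2⟩
    rw [hfilter]
    simp
  · intro h
    rw [card_support_Rrel hI hJ ⟨0, h 0⟩, Finset.filter_true_of_mem fun a _ t => h t a]
    simp
end

section
/- Let S be the iterated PBW sequence for Gr(3,6) given by S = ((1,6),(2,6),(3,6),(1,5),(2,5),(3,5),(1,4),(2,4),(3,4)). Then the 9×9 integer matrix whose rows, in order, are the valuations v_S(p̄_K) for K = (4,5,6), (1,5,6), (1,2,6), (3,4,5), (1,4,5), (1,2,5), (2,3,4), (1,3,4), (1,2,4) is triangular with 1s along the diagonal; in particular these nine vectors are linearly independent over ℚ, so the lowest-term valuation v_S has full rank 9. -/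
/-!
Common framework: iterated sequences for Gr(3,n), the matrix `A_S`, pullbacks of
Plücker coordinates, the weighted reverse lexicographic order, lowest-term
valuations, Plücker relations, weighting matrices and initial ideals.
-/

open MvPolynomial

noncomputable section

/-- The iterated PBW sequence
`S = ((1,6),(2,6),(3,6),(1,5),(2,5),(3,5),(1,4),(2,4),(3,4))` for `Gr(3,6)`. -/
def S17 : List (ℕ × ℕ) := [(1,6),(2,6),(3,6),(1,5),(2,5),(3,5),(1,4),(2,4),(3,4)]

/-- The nine Plücker indices `(4,5,6), (1,5,6), (1,2,6), (3,4,5), (1,4,5), (1,2,5),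
(2,3,4), (1,3,4), (1,2,4)`, in this order. -/
def K17 : Fin 9 → (Fin 3 → ℕ) :=
  ![![4,5,6], ![1,5,6], ![1,2,6], ![3,4,5], ![1,4,5], ![1,2,5], ![2,3,4], ![1,3,4], ![1,2,4]]

/-- The `9 × 9` matrix whose `r`-th row is the valuation `v_S(p̄_{K17 r})`, with
coordinates ordered as `β_1, …, β_9`. -/
def M17 : Matrix (Fin 9) (Fin 9) ℚ :=
  fun r l => ((valS 6 S17 (K17 r) (S17.getD (l : ℕ) (0,0)) : ℕ) : ℚ)

end

lemma lexLT.not_lexLE {S : List (ℕ × ℕ)} {a b : (ℕ × ℕ) →₀ ℕ} (h : lexLT S a b) :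
    ¬ lexLE S b a := by
  obtain ⟨k, hk, hlt, hkk⟩ := h
  rintro (⟨l, hl, hlt', hll⟩ | h)
  · rcases lt_trichotomy k l with hkl | rfl | hkl
    · exact hkk.ne (hlt' k hkl).symm
    · exact lt_asymm hkk hll
    · exact hll.ne (hlt l hkl).symm
  · exact hkk.ne (h k hk).symm

lemma psiLT.not_psiLE {S : List (ℕ × ℕ)} {a b : (ℕ × ℕ) →₀ ℕ} (h : psiLT S a b) :
    ¬ psiLE S b a := by
  rcases h with h | ⟨h, h'⟩ <;> rintro (g | ⟨g, g'⟩)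
  · omega
  · omega
  · omega
  · exact h'.not_lexLE g'

lemma psiLE_refl (S : List (ℕ × ℕ)) (a : (ℕ × ℕ) →₀ ℕ) : psiLE S a a :=
  Or.inr ⟨rfl, Or.inr fun _ _ => rfl⟩

lemma psiLT.psiLE {S : List (ℕ × ℕ)} {a b : (ℕ × ℕ) →₀ ℕ} (h : psiLT S a b) :
    psiLE S a b :=
  h.imp_right fun h => ⟨h.1, Or.inl h.2⟩

/-- A monomial in the support that is strictly below all the others is the minimum. -/
lemma minSupp_eq {S : List (ℕ × ℕ)} {f : MvPolynomial (ℕ × ℕ) ℂ} {m : (ℕ × ℕ) →₀ ℕ}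
    (hm : m ∈ f.support) (hlt : ∀ m' ∈ f.support, m' ≠ m → psiLT S m m') :
    minSupp S f = m := by
  have h : ∃ m ∈ f.support, ∀ m' ∈ f.support, psiLE S m m' := by
    refine ⟨m, hm, fun m' hm' => ?_⟩
    by_cases he : m' = m
    · exact he ▸ psiLE_refl S m'
    · exact (hlt m' hm' he).psiLE
  rw [minSupp, dif_pos h]
  by_contra hne
  exact (hlt _ h.choose_spec.1 hne).not_psiLE (h.choose_spec.2 m hm)

/-- The exponent vector of the product of the variables in a list. -/
noncomputable def expo (L : List (ℕ × ℕ)) : (ℕ × ℕ) →₀ ℕ := Multiset.toFinsupp (L : Multiset (ℕ × ℕ))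

lemma expo_apply (L : List (ℕ × ℕ)) (β : ℕ × ℕ) : expo L β = L.count β := by
  rw [expo, Multiset.toFinsupp_apply, Multiset.coe_count]
  congr!

lemma expo_cons (β : ℕ × ℕ) (L : List (ℕ × ℕ)) :
    expo (β :: L) = Finsupp.single β 1 + expo L := by
  rw [expo, ← Multiset.cons_coe, ← Multiset.singleton_add, Multiset.toFinsupp_add,
    Multiset.toFinsupp_singleton, expo]

lemma Psi_expo (L : List (ℕ × ℕ)) : Psi (expo L) = (L.map Ht).sum := by
  induction L with
  | nil => simp [expo, Psi]
  | cons β L ih =>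
    have hadd : Psi (Finsupp.single β 1 + expo L) = Psi (Finsupp.single β 1) + Psi (expo L) :=
      Finsupp.sum_add_index' (by simp) (by intros; ring)
    rw [expo_cons, hadd, ih]
    simp [Psi]

/-- The order `psiLT` between products of variables, in decidable form. -/
def ListLT (S L L' : List (ℕ × ℕ)) : Prop :=
  (L.map fun β => β.2 - β.1).sum < (L'.map fun β => β.2 - β.1).sum ∨
    ((L.map fun β => β.2 - β.1).sum = (L'.map fun β => β.2 - β.1).sum ∧
      ∃ k < S.length, (∀ m < k, L'.count (S.getD m (0,0)) = L.count (S.getD m (0,0))) ∧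
        L'.count (S.getD k (0,0)) < L.count (S.getD k (0,0)))

instance (S L L' : List (ℕ × ℕ)) : Decidable (ListLT S L L') := by
  unfold ListLT; infer_instance

lemma ListLT.psiLT {S L L' : List (ℕ × ℕ)} (h : ListLT S L L') :
    psiLT S (expo L) (expo L') := by
  simp only [_root_.psiLT, lexLT, Psi_expo, expo_apply]
  exact h

/-- The polynomial with the given integer coefficients and products of variables. -/
noncomputable def listPoly (T : List (ℤ × List (ℕ × ℕ))) : MvPolynomial (ℕ × ℕ) ℂ :=
  (T.map fun t => (t.1 : MvPolynomial (ℕ × ℕ) ℂ) * (t.2.map X).prod).sum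

lemma prod_map_X (L : List (ℕ × ℕ)) :
    (L.map X).prod = (monomial (expo L) 1 : MvPolynomial (ℕ × ℕ) ℂ) := by
  induction L with
  | nil => simp [expo]
  | cons β L ih => rw [List.map_cons, List.prod_cons, ih, expo_cons, X, monomial_mul, one_mul]

lemma listPoly_cons (t : ℤ × List (ℕ × ℕ)) (T : List (ℤ × List (ℕ × ℕ))) :
    listPoly (t :: T) = monomial (expo t.2) (t.1 : ℂ) + listPoly T := by
  rw [listPoly, List.map_cons, List.sum_cons, prod_map_X, ← listPoly,
    ← map_intCast (C : ℂ →+* MvPolynomial (ℕ × ℕ) ℂ), C_mul_monomial, mul_one]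

lemma exists_of_mem_support_listPoly {T : List (ℤ × List (ℕ × ℕ))} {m : (ℕ × ℕ) →₀ ℕ}
    (hm : m ∈ (listPoly T).support) : ∃ t ∈ T, m = expo t.2 := by
  induction T with
  | nil => simp [listPoly] at hm
  | cons t T ih =>
    rw [listPoly_cons] at hm
    rcases Finset.mem_union.1 (support_add hm) with h | h
    · exact ⟨t, by simp, Finset.mem_singleton.1 (support_monomial_subset h)⟩
    · obtain ⟨u, hu, rfl⟩ := ih h
      exact ⟨u, by simp [hu], rfl⟩

lemma minSupp_listPoly {S L : List (ℕ × ℕ)} {c : ℤ} {T : List (ℤ × List (ℕ × ℕ))}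
    (hc : c ≠ 0) (hT : ∀ t ∈ T, ListLT S L t.2) :
    minSupp S (listPoly ((c, L) :: T)) = expo L := by
  have hcoeff : coeff (expo L) (listPoly T) = 0 := by
    by_contra h
    obtain ⟨t, ht, he⟩ := exists_of_mem_support_listPoly (mem_support_iff.2 h)
    exact (he ▸ (hT t ht).psiLT).not_psiLE (psiLE_refl S _)
  refine minSupp_eq ?_ fun m' hm' hne => ?_
  · rw [mem_support_iff, listPoly_cons, coeff_add, coeff_monomial, if_pos rfl, hcoeff, add_zero]
    exact_mod_cast hc
  · obtain ⟨t, ht, rfl⟩ := exists_of_mem_support_listPoly hm'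
    rcases List.mem_cons.1 ht with rfl | ht
    · exact absurd rfl hne
    · exact (hT t ht).psiLT

lemma matMul_factor {n i j : ℕ} (A : NMat) {β : ℕ × ℕ} (hβ : β.1 ∈ Finset.Icc 1 n)
    (hj : j ∈ Finset.Icc 1 n) :
    matMul n A (factor β) i j = A i j + if j = β.2 then A i β.1 * X β else 0 := by
  simp only [matMul, factor, mul_add, Finset.sum_add_distrib, mul_ite, mul_one, mul_zero,
    Finset.sum_ite_eq', if_pos hj]
  congr 1
  split_ifs with h
  · simp only [h, and_true, Finset.sum_ite_eq', if_pos hβ]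
  · simp [h]

/-- If no two roots in `L` are composable, the product of the factors is linear. -/
lemma ASmat_apply {n r i j : ℕ} {L : List (ℕ × ℕ)} (hnd : L.Nodup)
    (hL : ∀ β ∈ L, 1 ≤ β.1 ∧ β.1 ≤ r ∧ r < β.2) (hr : r ≤ n) (hj : j ∈ Finset.Icc 1 n) :
    ASmat n L i j =
      (if i = j then 1 else 0) + if (i, j) ∈ L then X (i, j) else 0 := by
  induction L generalizing j with
  | nil => simp [ASmat, idN]
  | cons β L ih =>
    obtain ⟨hβ, hL⟩ := List.forall_mem_cons.1 hL
    obtain ⟨hβL, hnd⟩ := List.nodup_cons.1 hnd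
    have hβn : β.1 ∈ Finset.Icc 1 n := Finset.mem_Icc.2 ⟨hβ.1, hβ.2.1.trans hr⟩
    have hnot : (i, β.1) ∉ L := fun h => (hL _ h).2.2.not_ge hβ.2.1
    rw [ASmat, matMul_factor _ hβn hj, ih hnd hL hj, ih hnd hL hβn, if_neg hnot, add_zero,
      add_assoc]
    congr 1
    by_cases he : (i, j) = β
    · subst he
      simp [hβL]
    · have : ¬ (j = β.2 ∧ i = β.1) := fun h => he (Prod.ext h.2 h.1)
      simp only [List.mem_cons, he, false_or]
      by_cases h2 : j = β.2 <;> simp_all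

/-- The lowest monomial of each of the nine pullbacks. -/
def lead17 : Fin 9 → List (ℕ × ℕ) :=
  ![[(1,6),(2,5),(3,4)], [(2,6),(3,5)], [(3,6)], [(1,5),(2,4)], [(2,5),(3,4)], [(3,5)],
    [(1,4)], [(2,4)], [(3,4)]]

/-- The sign of the lowest term of each of the nine pullbacks. -/
def sign17 : Fin 9 → ℤ := ![-1, -1, 1, -1, -1, 1, 1, -1, 1]

/-- The remaining terms of each of the nine pullbacks. -/
def tail17 : Fin 9 → List (ℤ × List (ℕ × ℕ)) :=
  ![[(1, [(1,4),(2,5),(3,6)]), (-1, [(1,4),(2,6),(3,5)]), (-1, [(1,5),(2,4),(3,6)]),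
      (1, [(1,5),(2,6),(3,4)]), (1, [(1,6),(2,4),(3,5)])],
    [(1, [(2,5),(3,6)])], [], [(1, [(1,4),(2,5)])], [(1, [(2,4),(3,5)])], [], [], [], []]

lemma ASmat_S17 {i j : ℕ} (hj : j ∈ Finset.Icc 1 6) :
    ASmat 6 S17 i j = (if i = j then 1 else 0) + if (i, j) ∈ S17 then X (i, j) else 0 :=
  ASmat_apply (r := 3) (by decide) (by decide) (by norm_num) hj

lemma phiStar_K17 (r : Fin 9) :
    phiStar 6 S17 (K17 r) = listPoly ((sign17 r, lead17 r) :: tail17 r) := by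
  have hK : ∀ r b, K17 r b ∈ Finset.Icc 1 6 := by decide
  simp only [phiStar, Matrix.det_fin_three, Matrix.of_apply, ASmat_S17 (hK _ _)]
  fin_cases r <;>
    simp [K17, S17, listPoly, sign17, lead17, tail17] <;> try ring

lemma valS_K17 (r : Fin 9) : valS 6 S17 (K17 r) = expo (lead17 r) := by
  rw [valS, phiStar_K17]
  refine minSupp_listPoly ?_ ?_
  · revert r; decide
  · revert r; decide

lemma M17_apply (r l : Fin 9) :
    M17 r l = ((lead17 r).count (S17.getD (l : ℕ) (0,0)) : ℚ) := by
  rw [M17, valS_K17, expo_apply]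

/-- The matrix of the valuations of the nine listed Plücker coordinates is triangular
with 1s along the diagonal; in particular its rows are linearly independent over `ℚ`,
so the lowest-term valuation `v_S` has full rank 9. -/
theorem weighting_matrix_triangular :
    (∀ r : Fin 9, M17 r r = 1) ∧
    (∀ r l : Fin 9, (l : ℕ) < (r : ℕ) → M17 r l = 0) ∧
    LinearIndependent ℚ (fun r : Fin 9 => M17 r) := by
  have hdiag : ∀ r : Fin 9, M17 r r = 1 := fun r => by
    have h : ∀ r : Fin 9, (lead17 r).count (S17.getD (r : ℕ) (0,0)) = 1 := by decide
    rw [M17_apply, h, Nat.cast_one]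
  have hlow : ∀ r l : Fin 9, (l : ℕ) < (r : ℕ) → M17 r l = 0 := fun r l hlr => by
    have h : ∀ r l : Fin 9, (l : ℕ) < (r : ℕ) →
        (lead17 r).count (S17.getD (l : ℕ) (0,0)) = 0 := by decide
    rw [M17_apply, h r l hlr, Nat.cast_zero]
  refine ⟨hdiag, hlow, Matrix.linearIndependent_rows_iff_isUnit (A := M17).2 ?_⟩
  have htri : M17.IsUpperTriangular := fun r l hlr => hlow r l hlr
  rw [Matrix.isUnit_iff_isUnit_det, Matrix.det_of_isUpperTriangular htri]
  simp [hdiag]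
end
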